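/- Let V be an n×m real matrix such that 0 lies in the interior of C_V(V). For every x ∈ ℝⁿ, the function ψ_V(x) = inf{1ᵀp : x = Vp, p ≥ 0} coincides with the Minkowski functional of C_V(V), i.e. ψ_V(x) = inf{r ∈ ℝ : r > 0 and x ∈ r·C_V(V)}. -/

import Mathlib

open Matrix Pointwise

/-- The V-representation polyhedron `C_V(V)`: the convex hull of the columns of `V`,
`{x : x = Vp, p ≥ 0, 1ᵀp = 1}`. -/
def polyV {n m : ℕ} (V : Matrix (Fin n) (Fin m) ℝ) : Set (Fin n → ℝ) :=
  {x | ∃ p : Fin m → ℝ, (∀ i, 0 ≤ p i) ∧ (∑ i, p i) = 1 ∧ x = V.mulVec p}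

/-- The gauge function `ψ_V(x) = inf {1ᵀp : x = Vp, p ≥ 0}`. -/
noncomputable def psiV {n m : ℕ} (V : Matrix (Fin n) (Fin m) ℝ) (x : Fin n → ℝ) : ℝ :=
  sInf {r : ℝ | ∃ p : Fin m → ℝ, (∀ i, 0 ≤ p i) ∧ x = V.mulVec p ∧ (∑ i, p i) = r}

/-- The subdifferential `∂ψ_V(x) = {h : ψ_V(y) − ψ_V(x) ≥ hᵀ(y − x) for all y}`. -/
def subdiffV {n m : ℕ} (V : Matrix (Fin n) (Fin m) ℝ) (x : Fin n → ℝ) : Set (Fin n → ℝ) :=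
  {h | ∀ y : Fin n → ℝ, psiV V y - psiV V x ≥ h ⬝ᵥ (y - x)}

/-- The positive dilations of `polyV V` containing `x` are the positive values of `1ᵀp` over the
nonnegative representations `x = Vp`. -/
theorem mem_smul_polyV_iff {n m : ℕ} (V : Matrix (Fin n) (Fin m) ℝ) {r : ℝ} (hr : 0 < r)
    (x : Fin n → ℝ) :
    x ∈ r • polyV V ↔
      ∃ p : Fin m → ℝ, (∀ i, 0 ≤ p i) ∧ x = V.mulVec p ∧ (∑ i, p i) = r := by
  constructor
  · rintro ⟨_, ⟨p, hp, hsum, rfl⟩, rfl⟩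
    refine ⟨r • p, fun i => mul_nonneg hr.le (hp i), (Matrix.mulVec_smul V r p).symm, ?_⟩
    simp [← Finset.mul_sum, hsum]
  · rintro ⟨p, hp, rfl, hsum⟩
    refine ⟨V.mulVec (r⁻¹ • p), ⟨r⁻¹ • p, fun i => mul_nonneg (inv_nonneg.2 hr.le) (hp i), ?_, rfl⟩,
      ?_⟩
    · simp [← Finset.mul_sum, hsum, hr.ne']
    · simp [Matrix.mulVec_smul, smul_smul, hr.ne']

/-- A neighbourhood of the origin has a positive dilation containing any given point. -/
theorem exists_pos_mem_smul_of_mem_nhds_zero {E : Type*} [AddCommGroup E] [Module ℝ E]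
    [TopologicalSpace E] [ContinuousSMul ℝ E] {s : Set E} (hs : s ∈ nhds (0 : E)) (x : E) :
    ∃ r : ℝ, 0 < r ∧ x ∈ r • s := by
  obtain ⟨r, hr, h⟩ := ((absorbent_nhds_zero (𝕜 := ℝ) hs) x).exists_pos
  exact ⟨r, hr, Set.singleton_subset_iff.1 (h r (le_abs_self r))⟩

theorem stmt3 {n m : ℕ} (V : Matrix (Fin n) (Fin m) ℝ)
    (hV : (0 : Fin n → ℝ) ∈ interior (polyV V)) (x : Fin n → ℝ) :
    psiV V x = sInf {r : ℝ | 0 < r ∧ x ∈ r • polyV V} := by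
  have hbdd : BddBelow {r : ℝ | ∃ p : Fin m → ℝ,
      (∀ i, 0 ≤ p i) ∧ x = V.mulVec p ∧ (∑ i, p i) = r} := by
    refine ⟨0, ?_⟩
    rintro _ ⟨p, hp, -, rfl⟩
    exact Finset.sum_nonneg fun i _ => hp i
  obtain ⟨r₀, hr₀, hx₀⟩ := exists_pos_mem_smul_of_mem_nhds_zero (mem_interior_iff_mem_nhds.1 hV) x
  obtain ⟨q, hq, hqsum, hVq⟩ := interior_subset hV
  apply le_antisymm
  · exact csInf_le_csInf hbdd ⟨r₀, hr₀, hx₀⟩ fun r hr => (mem_smul_polyV_iff V hr.1 x).1 hr.2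
  · refine le_csInf ⟨r₀, (mem_smul_polyV_iff V hr₀ x).1 hx₀⟩ ?_
    rintro _ ⟨p, hp, hpx, rfl⟩
    refine le_of_forall_pos_le_add fun ε hε => csInf_le ⟨0, fun r hr => hr.1.le⟩ ?_
    have hpos : 0 < (∑ i, p i) + ε := add_pos_of_nonneg_of_pos (Finset.sum_nonneg fun i _ => hp i) hε
    refine ⟨hpos, (mem_smul_polyV_iff V hpos x).2
      ⟨p + ε • q, fun i => add_nonneg (hp i) (mul_nonneg hε.le (hq i)), ?_, ?_⟩⟩
    · rw [Matrix.mulVec_add, Matrix.mulVec_smul, ← hVq, smul_zero, add_zero, hpx]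
    · simp [Finset.sum_add_distrib, ← Finset.mul_sum, hqsum]
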